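/- Let α ∈ (0,1) and let y be continuous on [0,∞) with y(0) finite, and suppose x y'(x) → 0 as x → 0⁺ and x ↦ x y'(x) is continuous. If y satisfies x^α D₀^α(x y') = x² y for x > 0, then y satisfies the Volterra integro-differential equation y'(x) = (1/Γ(α)) (1/x) ∫₀^x (x-t)^{α-1} t^{2-α} y(t) dt for x > 0. -/

import Mathlib

open Real intervalIntegral

/-- Riemann–Liouville fractional integral of order `μ`. -/
noncomputable def fracInt (μ : ℝ) (y : ℝ → ℝ) (x : ℝ) : ℝ :=
  (1 / Real.Gamma μ) * ∫ t in (0:ℝ)..x, (x - t) ^ (μ - 1) * y t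

/-- Riemann–Liouville fractional derivative of order `α`. -/
noncomputable def fracDeriv (α : ℝ) (y : ℝ → ℝ) (x : ℝ) : ℝ :=
  deriv (fracInt (1 - α) y) x

open MeasureTheory Set Filter Topology

/-- The incomplete beta integral with exponents `α - 1` and `-α`. -/
noncomputable def incBeta (α c : ℝ) : ℝ :=
  ∫ u in (0:ℝ)..c, u ^ (α - 1) * (1 - u) ^ (-α)

/-- The Abel kernel `r ^ (-α)`, extended by zero to `r ≤ 0`. -/
noncomputable def abelKernel (α : ℝ) : ℝ → ℝ :=
  (Ioi (0:ℝ)).indicator fun r => r ^ (-α)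

/-- The convolution of the Abel kernel with `s ^ (α - 1)` truncated to `0 < s ≤ ε`. -/
noncomputable def truncKernel (α ε r : ℝ) : ℝ :=
  if 0 < r then incBeta α (min 1 (ε / r)) else 0

lemma ofReal_beta_integrand {α u : ℝ} (hu : u ∈ Icc (0:ℝ) 1) :
    (u : ℂ) ^ ((α : ℂ) - 1) * (1 - (u : ℂ)) ^ (((1 - α : ℝ) : ℂ) - 1) =
      ((u ^ (α - 1) * (1 - u) ^ (-α) : ℝ) : ℂ) := by
  have h1 : (0:ℝ) ≤ 1 - u := by linarith [hu.2]
  rw [Complex.ofReal_mul, Complex.ofReal_cpow hu.1, Complex.ofReal_cpow h1]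
  push_cast
  congr 2
  ring

lemma intervalIntegrable_beta {α : ℝ} (hα : α ∈ Ioo (0:ℝ) 1) :
    IntervalIntegrable (fun u : ℝ => u ^ (α - 1) * (1 - u) ^ (-α)) volume 0 1 := by
  have h := Complex.betaIntegral_convergent (u := (α : ℂ)) (v := ((1 - α : ℝ) : ℂ))
    (by simpa using hα.1) (by simpa using hα.2)
  refine h.norm.congr ?_
  rw [uIoc_of_le zero_le_one]
  intro u hu
  have hu' : u ∈ Icc (0:ℝ) 1 := ⟨hu.1.le, hu.2⟩
  simp only
  rw [ofReal_beta_integrand hu', Complex.norm_real, Real.norm_of_nonneg]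
  exact mul_nonneg (Real.rpow_nonneg hu'.1 _) (Real.rpow_nonneg (by linarith [hu.2]) _)

lemma incBeta_one {α : ℝ} (hα : α ∈ Ioo (0:ℝ) 1) :
    incBeta α 1 = Real.Gamma α * Real.Gamma (1 - α) := by
  have h := ProbabilityTheory.beta_eq_betaIntegralReal α (1 - α) hα.1 (by linarith [hα.2])
  have h2 : Complex.betaIntegral (α : ℂ) ((1 - α : ℝ) : ℂ) = (incBeta α 1 : ℂ) := by
    rw [Complex.betaIntegral, incBeta, ← intervalIntegral.integral_ofReal]
    refine intervalIntegral.integral_congr fun u hu => ?_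
    rw [uIcc_of_le zero_le_one] at hu
    exact ofReal_beta_integrand hu
  rw [h2, Complex.ofReal_re] at h
  rw [← h, ProbabilityTheory.beta]
  simp

lemma incBeta_mono {α : ℝ} (hα : α ∈ Ioo (0:ℝ) 1) {c d : ℝ} (hc : 0 ≤ c) (hcd : c ≤ d)
    (hd : d ≤ 1) : incBeta α c ≤ incBeta α d := by
  have hi := intervalIntegrable_beta hα
  refine intervalIntegral.integral_mono_interval le_rfl hc hcd ?_ ?_
  · refine (ae_restrict_iff' measurableSet_Ioc).2 (Eventually.of_forall fun u hu => ?_)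
    exact mul_nonneg (Real.rpow_nonneg hu.1.le _) (Real.rpow_nonneg (by linarith [hu.2]) _)
  · refine hi.mono_set ?_
    rw [uIcc_of_le (hc.trans hcd), uIcc_of_le zero_le_one]
    exact Icc_subset_Icc le_rfl hd

lemma incBeta_pos {α : ℝ} (hα : α ∈ Ioo (0:ℝ) 1) {c : ℝ} (hc : 0 < c) (hc1 : c ≤ 1) :
    0 < incBeta α c := by
  refine intervalIntegral.intervalIntegral_pos_of_pos_on ?_ ?_ hc
  · refine (intervalIntegrable_beta hα).mono_set ?_
    rw [uIcc_of_le hc.le, uIcc_of_le zero_le_one]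
    exact Icc_subset_Icc le_rfl hc1
  · intro u hu
    exact mul_pos (Real.rpow_pos_of_pos hu.1 _) (Real.rpow_pos_of_pos (by linarith [hu.2]) _)

lemma truncKernel_of_nonpos (α ε : ℝ) {r : ℝ} (hr : r ≤ 0) : truncKernel α ε r = 0 :=
  if_neg hr.not_gt

lemma truncKernel_pos {α : ℝ} (hα : α ∈ Ioo (0:ℝ) 1) {ε r : ℝ} (hε : 0 < ε) (hr : 0 < r) :
    0 < truncKernel α ε r := by
  rw [truncKernel, if_pos hr]
  exact incBeta_pos hα (lt_min one_pos (div_pos hε hr)) (min_le_left _ _)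

lemma truncKernel_nonneg {α : ℝ} (hα : α ∈ Ioo (0:ℝ) 1) {ε : ℝ} (hε : 0 < ε) (r : ℝ) :
    0 ≤ truncKernel α ε r := by
  rcases le_or_gt r 0 with hr | hr
  · rw [truncKernel_of_nonpos α ε hr]
  · exact (truncKernel_pos hα hε hr).le

lemma truncKernel_of_le {α ε r : ℝ} (hr : 0 < r) (hrε : r ≤ ε) :
    truncKernel α ε r = incBeta α 1 := by
  rw [truncKernel, if_pos hr, min_eq_left ((one_le_div hr).2 hrε)]

lemma truncKernel_anti {α : ℝ} (hα : α ∈ Ioo (0:ℝ) 1) {ε r r' : ℝ} (hε : 0 < ε) (hr : 0 < r)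
    (hrr : r ≤ r') : truncKernel α ε r' ≤ truncKernel α ε r := by
  have hr' := hr.trans_le hrr
  rw [truncKernel, truncKernel, if_pos hr, if_pos hr']
  refine incBeta_mono hα (le_min zero_le_one (div_nonneg hε.le hr'.le)) ?_ (min_le_left _ _)
  gcongr

lemma truncKernel_le {α : ℝ} (hα : α ∈ Ioo (0:ℝ) 1) {ε : ℝ} (hε : 0 < ε) (r : ℝ) :
    truncKernel α ε r ≤ incBeta α 1 := by
  rcases le_or_gt r 0 with hr | hr
  · rw [truncKernel_of_nonpos α ε hr]
    exact (incBeta_pos hα one_pos le_rfl).le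
  · rw [truncKernel, if_pos hr]
    exact incBeta_mono hα (le_min zero_le_one (div_nonneg hε.le hr.le)) (min_le_left _ _) le_rfl

lemma measurable_truncKernel {α : ℝ} (hα : α ∈ Ioo (0:ℝ) 1) {ε : ℝ} (hε : 0 < ε) :
    Measurable (truncKernel α ε) := by
  have h : Antitone fun r => if 0 < r then truncKernel α ε r else incBeta α 1 := by
    intro r r' hrr
    simp only
    split_ifs with h1 h2 h2
    · exact truncKernel_anti hα hε h2 hrr
    · exact truncKernel_le hα hε _
    · exact absurd (h2.trans_le hrr) h1
    · exact le_rfl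
  have h2 : truncKernel α ε =
      (Ioi (0:ℝ)).indicator fun r => if 0 < r then truncKernel α ε r else incBeta α 1 := by
    funext r
    rcases le_or_gt r 0 with hr | hr
    · rw [truncKernel_of_nonpos α ε hr, indicator_of_notMem (by simpa using hr)]
    · rw [indicator_of_mem (by simpa using hr)]
      simp [hr]
  rw [h2]
  exact h.measurable.indicator measurableSet_Ioi

lemma intervalIntegrable_truncKernel_mul {α : ℝ} (hα : α ∈ Ioo (0:ℝ) 1) {ε : ℝ} (hε : 0 < ε)
    {g : ℝ → ℝ} (hg : Continuous g) (x a b : ℝ) :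
    IntervalIntegrable (fun t => truncKernel α ε (x - t) * g t) volume a b := by
  rw [intervalIntegrable_iff]
  refine (hg.intervalIntegrable a b).def'.bdd_mul (c := incBeta α 1) ?_ ?_
  · exact ((measurable_truncKernel hα hε).comp (measurable_const.sub measurable_id)
      ).aestronglyMeasurable
  · refine Eventually.of_forall fun t => ?_
    rw [Real.norm_of_nonneg (truncKernel_nonneg hα hε _)]
    exact truncKernel_le hα hε _

lemma integral_rpow_mul_abelKernel {α : ℝ} (hα : α ∈ Ioo (0:ℝ) 1) {ε : ℝ} (hε : 0 < ε) (r : ℝ) :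
    ∫ s in (0:ℝ)..ε, s ^ (α - 1) * abelKernel α (r - s) = truncKernel α ε r := by
  rcases le_or_gt r 0 with hr | hr
  · rw [truncKernel_of_nonpos α ε hr]
    refine intervalIntegral.integral_zero_ae (Eventually.of_forall fun s hs => ?_)
    rw [uIoc_of_le hε.le] at hs
    rw [abelKernel, indicator_of_notMem, mul_zero]
    simp only [mem_Ioi, not_lt]
    linarith [hs.1]
  have h1 : ∀ c, 0 ≤ c → c ≤ r →
      ∫ s in (0:ℝ)..c, s ^ (α - 1) * abelKernel α (r - s) = incBeta α (c / r) := by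
    intro c hc hcr
    have := intervalIntegral.integral_comp_mul_left (a := 0) (b := c / r)
      (fun s => s ^ (α - 1) * abelKernel α (r - s)) hr.ne'
    rw [mul_zero, mul_div_cancel₀ _ hr.ne', smul_eq_mul, eq_comm, inv_mul_eq_iff_eq_mul₀ hr.ne',
      ← intervalIntegral.integral_const_mul] at this
    rw [this, incBeta]
    refine intervalIntegral.integral_congr fun u hu => ?_
    have hcr' : c / r ≤ 1 := (div_le_one hr).2 hcr
    rw [uIcc_of_le (by positivity)] at hu
    have hu1 : 0 ≤ 1 - u := by linarith [hu.2]
    have e1 : abelKernel α (r - r * u) = (r * (1 - u)) ^ (-α) := by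
      rw [abelKernel, show r - r * u = r * (1 - u) by ring]
      rcases hu1.eq_or_lt with h | h
      · rw [← h, mul_zero, indicator_of_notMem (by simp), Real.zero_rpow (by linarith [hα.1])]
      · rw [indicator_of_mem (by simpa using mul_pos hr h)]
    simp only [e1]
    rw [Real.mul_rpow hr.le hu.1, Real.mul_rpow hr.le hu1]
    have : r * (r ^ (α - 1) * r ^ (-α)) = 1 := by
      rw [← Real.rpow_add hr]
      ring_nf
      rw [Real.rpow_neg_one, mul_inv_cancel₀ hr.ne']
    linear_combination (u ^ (α - 1) * (1 - u) ^ (-α)) * this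
  rw [truncKernel, if_pos hr]
  rcases le_total ε r with h | h
  · rw [h1 ε hε.le h, min_eq_right ((div_le_one hr).2 h)]
  · have h2 := h1 r hr.le le_rfl
    rw [div_self hr.ne'] at h2
    rw [min_eq_left ((one_le_div hr).2 h), ← h2,
      intervalIntegral.integral_of_le hε.le, intervalIntegral.integral_of_le hr.le]
    refine setIntegral_eq_of_subset_of_forall_sdiff_eq_zero (E := ℝ) measurableSet_Ioc
      (Ioc_subset_Ioc_right h) fun s hs => ?_
    rw [abelKernel, indicator_of_notMem, mul_zero]
    simp only [mem_Ioi, not_lt, sub_nonpos]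
    by_contra! hsr
    exact hs.2 ⟨hs.1.1, hsr.le⟩

lemma rpow_neg_sub_rpow_neg_antitoneOn {α δ : ℝ} (hα : 0 ≤ α) (hδ : 0 ≤ δ) :
    AntitoneOn (fun q : ℝ => q ^ (-α) - (q + δ) ^ (-α)) (Ioi 0) := by
  have hd : ∀ q ∈ Ioi (0:ℝ), HasDerivAt (fun q : ℝ => q ^ (-α) - (q + δ) ^ (-α))
      (1 * -α * q ^ (-α - 1) - 1 * -α * (q + δ) ^ (-α - 1)) q := by
    intro q hq
    have hq' : 0 < q + δ := add_pos_of_pos_of_nonneg hq hδ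
    exact ((hasDerivAt_id q).rpow_const (Or.inl (ne_of_gt hq))).sub
      (((hasDerivAt_id q).add_const δ).rpow_const (Or.inl hq'.ne'))
  refine antitoneOn_of_deriv_nonpos (convex_Ioi 0)
    (fun q hq => (hd q hq).continuousAt.continuousWithinAt) ?_ ?_
  · rw [interior_Ioi]
    exact fun q hq => (hd q hq).differentiableAt.differentiableWithinAt
  · rw [interior_Ioi]
    intro q hq
    rw [(hd q hq).deriv]
    have := Real.rpow_le_rpow_of_nonpos hq (show q ≤ q + δ by linarith)
      (show -α - 1 ≤ 0 by linarith)
    nlinarith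

lemma truncKernel_sub_le {α : ℝ} (hα : α ∈ Ioo (0:ℝ) 1) {ε p δ d : ℝ} (hε : 0 < ε) (hp : ε < p)
    (hδ : 0 ≤ δ) (hd : 0 ≤ d) :
    truncKernel α ε (p + d) - truncKernel α ε (p + d + δ) ≤
      truncKernel α ε p - truncKernel α ε (p + δ) := by
  have hk : ∀ r, ε < r → ∀ s ∈ Icc 0 ε, abelKernel α (r - s) = (r - s) ^ (-α) := by
    intro r hr s hs
    rw [abelKernel, indicator_of_mem]
    simp only [mem_Ioi, sub_pos]
    linarith [hs.2]
  have hi : ∀ r, ε < r →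
      IntervalIntegrable (fun s => s ^ (α - 1) * abelKernel α (r - s)) volume 0 ε := by
    intro r hr
    refine (intervalIntegral.intervalIntegrable_rpow' (by linarith [hα.1])).mul_continuousOn ?_
    rw [uIcc_of_le hε.le]
    refine ContinuousOn.congr (f := fun s => (r - s) ^ (-α)) ?_ (hk r hr)
    refine ContinuousOn.rpow_const (by fun_prop) fun s hs => Or.inl ?_
    linarith [hs.2]
  simp only [← integral_rpow_mul_abelKernel hα hε]
  rw [← intervalIntegral.integral_sub (hi _ (by linarith)) (hi _ (by linarith)),
    ← intervalIntegral.integral_sub (hi _ hp) (hi _ (by linarith))]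
  refine intervalIntegral.integral_mono_on hε.le ((hi _ (by linarith)).sub (hi _ (by linarith)))
    ((hi _ hp).sub (hi _ (by linarith))) fun s hs => ?_
  rw [hk (p + d) (by linarith) s hs, hk (p + d + δ) (by linarith) s hs, hk p hp s hs,
    hk (p + δ) (by linarith) s hs,
    ← mul_sub, ← mul_sub]
  refine mul_le_mul_of_nonneg_left ?_ (Real.rpow_nonneg hs.1 _)
  have hq : 0 < p - s := by linarith [hs.2]
  have h := rpow_neg_sub_rpow_neg_antitoneOn hα.1.le hδ (mem_Ioi.2 hq)
    (mem_Ioi.2 (add_pos_of_pos_of_nonneg hq hd)) (le_add_of_nonneg_right hd)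
  simp only at h
  convert h using 3 <;> ring

lemma measurable_abelKernel (α : ℝ) : Measurable (abelKernel α) :=
  (measurable_id.pow_const _).indicator measurableSet_Ioi

lemma abelKernel_nonneg (α r : ℝ) : 0 ≤ abelKernel α r :=
  indicator_nonneg (fun _ hr => Real.rpow_nonneg (le_of_lt hr) _) r

lemma intervalIntegrable_abelKernel {α : ℝ} (hα : α < 1) (a b : ℝ) :
    IntervalIntegrable (abelKernel α) volume a b := by
  rw [intervalIntegrable_iff]
  exact (intervalIntegral.intervalIntegrable_rpow' (by linarith)).def'.indicator measurableSet_Ioi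

lemma integral_abelKernel_mul {α z X : ℝ} (hz : z ≤ X) (hz0 : 0 ≤ z) (g : ℝ → ℝ) :
    ∫ t in (0:ℝ)..X, abelKernel α (z - t) * g t =
      ∫ t in (0:ℝ)..z, (z - t) ^ (1 - α - 1) * g t := by
  rw [intervalIntegral.integral_of_le hz0, intervalIntegral.integral_of_le (hz0.trans hz),
    integral_Ioc_eq_integral_Ioo, integral_Ioc_eq_integral_Ioo]
  rw [setIntegral_eq_of_subset_of_forall_sdiff_eq_zero measurableSet_Ioo
    (Ioo_subset_Ioo_right hz)]
  · refine setIntegral_congr_fun measurableSet_Ioo fun t ht => ?_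
    rw [abelKernel, indicator_of_mem (by simpa using ht.2), sub_sub_cancel_left]
  · intro t ht
    rw [abelKernel, indicator_of_notMem, zero_mul]
    simp only [mem_Ioi, not_lt, sub_nonpos]
    by_contra! h
    exact ht.2 ⟨ht.1.1, h⟩

lemma integral_rpow_mul_fracInt {α : ℝ} (hα : α ∈ Ioo (0:ℝ) 1) {g : ℝ → ℝ} (hg : Continuous g)
    {ε x X : ℝ} (hε : 0 < ε) (hεx : ε ≤ x) (hxX : x ≤ X) :
    ∫ s in (0:ℝ)..ε, s ^ (α - 1) * fracInt (1 - α) g (x - s) =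
      (1 / Real.Gamma (1 - α)) * ∫ t in (0:ℝ)..X, truncKernel α ε (x - t) * g t := by
  have hX : 0 ≤ X := by linarith
  obtain ⟨M, hM⟩ := isCompact_Icc.exists_bound_of_continuousOn
    (hg.continuousOn (s := Icc 0 X))
  set C := ∫ r in (-X)..X, abelKernel α r with hC
  set Φ : ℝ → ℝ → ℝ := fun s t => s ^ (α - 1) * (abelKernel α (x - s - t) * g t) with hΦ
  have hmeas : Measurable (Function.uncurry Φ) := by
    refine Measurable.mul ?_ (Measurable.mul ?_ ?_)
    · exact measurable_fst.pow_const _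
    · exact (measurable_abelKernel α).comp
        ((measurable_const.sub measurable_fst).sub measurable_snd)
    · exact hg.measurable.comp measurable_snd
  have hsec : ∀ s, IntervalIntegrable (fun t => abelKernel α (x - s - t) * g t) volume 0 X := by
    intro s
    refine IntervalIntegrable.mul_continuousOn ?_ hg.continuousOn
    exact ((intervalIntegrable_abelKernel hα.2 (x - s) (x - s - X)).comp_sub_left (x - s)
      enorm_ne_top).mono_set (by simp)
  have hint : Integrable (Function.uncurry Φ)
      ((volume.restrict (uIoc 0 ε)).prod (volume.restrict (uIoc 0 X))) := by
    rw [integrable_prod_iff hmeas.aestronglyMeasurable]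
    constructor
    · refine Eventually.of_forall fun s => ?_
      exact ((hsec s).const_mul (s ^ (α - 1))).def'
    · refine Integrable.mono' (g := fun s => s ^ (α - 1) * (C * M))
        ((intervalIntegral.intervalIntegrable_rpow' (by linarith [hα.1])).def'.mul_const _)
        (hmeas.aestronglyMeasurable.norm.integral_prod_right') ?_
      refine (ae_restrict_iff' measurableSet_uIoc).2 (Eventually.of_forall fun s hs => ?_)
      rw [uIoc_of_le hε.le] at hs
      have hs0 := Real.rpow_nonneg hs.1.le (α - 1)
      rw [Real.norm_of_nonneg (integral_nonneg fun t => norm_nonneg _)]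
      simp only [Function.uncurry, hΦ, norm_mul]
      rw [MeasureTheory.integral_const_mul, Real.norm_of_nonneg hs0]
      refine mul_le_mul_of_nonneg_left ?_ hs0
      have hab : ∀ r, ‖abelKernel α r‖ = abelKernel α r := fun r =>
        Real.norm_of_nonneg (abelKernel_nonneg α r)
      have hM0 : 0 ≤ M := (norm_nonneg _).trans (hM 0 ⟨le_rfl, hX⟩)
      have hi1 : IntervalIntegrable (fun t => abelKernel α (x - s - t)) volume 0 X :=
        ((intervalIntegrable_abelKernel hα.2 (x - s) (x - s - X)).comp_sub_left (x - s)
          enorm_ne_top).mono_set (by simp)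
      rw [uIoc_of_le hX, ← intervalIntegral.integral_of_le hX]
      calc ∫ t in (0:ℝ)..X, ‖abelKernel α (x - s - t)‖ * ‖g t‖
          ≤ ∫ t in (0:ℝ)..X, abelKernel α (x - s - t) * M := by
            refine intervalIntegral.integral_mono_on hX ?_ (hi1.mul_const _) fun t ht => ?_
            · simpa [norm_mul] using (hsec s).norm
            · rw [hab]
              exact mul_le_mul_of_nonneg_left (hM t ht) (abelKernel_nonneg α _)
        _ = (∫ r in (x - s - X)..(x - s), abelKernel α r) * M := by
            rw [intervalIntegral.integral_mul_const, intervalIntegral.integral_comp_sub_left]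
            simp
        _ ≤ C * M := by
            refine mul_le_mul_of_nonneg_right ?_ hM0
            refine intervalIntegral.integral_mono_interval ?_ ?_ ?_ ?_
              (intervalIntegrable_abelKernel hα.2 _ _)
            · linarith [hs.2]
            · linarith
            · linarith [hs.1]
            · exact Eventually.of_forall fun r => abelKernel_nonneg α r
  have hswap := intervalIntegral_intervalIntegral_swap (F := Φ) (a := 0) (b := ε) (c := 0)
    (d := X) (by
    rwa [IntegrableOn, Measure.volume_eq_prod, ← Measure.prod_restrict])
  have hL : ∫ s in (0:ℝ)..ε, s ^ (α - 1) * fracInt (1 - α) g (x - s) =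
      (1 / Real.Gamma (1 - α)) * ∫ s in (0:ℝ)..ε, ∫ t in (0:ℝ)..X, Φ s t := by
    rw [← intervalIntegral.integral_const_mul]
    refine intervalIntegral.integral_congr fun s hs => ?_
    rw [uIcc_of_le hε.le] at hs
    simp only [hΦ, fracInt]
    rw [intervalIntegral.integral_const_mul,
      integral_abelKernel_mul (by linarith [hs.1]) (by linarith [hs.2])]
    ring
  rw [hL, hswap]
  congr 1
  refine intervalIntegral.integral_congr fun t _ => ?_
  simp only [hΦ]
  rw [← integral_rpow_mul_abelKernel hα hε, ← intervalIntegral.integral_mul_const]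
  refine intervalIntegral.integral_congr fun s _ => ?_
  simp only [sub_right_comm x s t]
  ring

lemma fracInt_fracInt {α : ℝ} (hα : α ∈ Ioo (0:ℝ) 1) {g : ℝ → ℝ} (hg : Continuous g)
    {x : ℝ} (hx : 0 < x) :
    fracInt α (fracInt (1 - α) g) x = ∫ t in (0:ℝ)..x, g t := by
  have h := integral_rpow_mul_fracInt hα hg hx le_rfl le_rfl
  have h1 : ∫ t in (0:ℝ)..x, truncKernel α x (x - t) * g t =
      incBeta α 1 * ∫ t in (0:ℝ)..x, g t := by
    rw [← intervalIntegral.integral_const_mul, intervalIntegral.integral_of_le hx.le,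
      intervalIntegral.integral_of_le hx.le, integral_Ioc_eq_integral_Ioo,
      integral_Ioc_eq_integral_Ioo]
    refine setIntegral_congr_fun measurableSet_Ioo fun t ht => ?_
    rw [truncKernel_of_le (by linarith [ht.2]) (by linarith [ht.1])]
  have h2 := intervalIntegral.integral_comp_sub_left (E := ℝ) (a := 0) (b := x)
    (fun s => s ^ (α - 1) * fracInt (1 - α) g (x - s)) x
  simp only [sub_sub_cancel, sub_self, sub_zero] at h2
  rw [fracInt, h2, h, h1, incBeta_one hα]
  have := (Real.Gamma_pos_of_pos hα.1).ne'
  have := (Real.Gamma_pos_of_pos (s := 1 - α) (by linarith [hα.2])).ne'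
  field_simp

lemma fracInt_eq_rpow_mul {μ x : ℝ} (hμ : 0 < μ) (hx : 0 ≤ x) (g : ℝ → ℝ) :
    fracInt μ g x =
      (1 / Real.Gamma μ) * (x ^ μ * ∫ u in (0:ℝ)..1, (1 - u) ^ (μ - 1) * g (x * u)) := by
  rcases hx.eq_or_lt with rfl | hx
  · simp [fracInt, Real.zero_rpow hμ.ne']
  have h := intervalIntegral.integral_comp_mul_left (E := ℝ) (a := 0) (b := 1)
    (fun t => (x - t) ^ (μ - 1) * g t) hx.ne'
  rw [mul_zero, mul_one, smul_eq_mul, eq_comm, inv_mul_eq_iff_eq_mul₀ hx.ne',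
    ← intervalIntegral.integral_const_mul] at h
  rw [fracInt, h]
  congr 1
  rw [← intervalIntegral.integral_const_mul]
  refine intervalIntegral.integral_congr fun u hu => ?_
  rw [uIcc_of_le zero_le_one] at hu
  rw [show x - x * u = x * (1 - u) by ring, Real.mul_rpow hx.le (by linarith [hu.2]),
    Real.rpow_sub_one hx.ne']
  field_simp

lemma continuousOn_fracInt {μ : ℝ} (hμ : 0 < μ) {g : ℝ → ℝ} (hg : Continuous g) :
    ContinuousOn (fracInt μ g) (Ici 0) := by
  have hc : Continuous fun x : ℝ =>
      (1 / Real.Gamma μ) * (x ^ μ * ∫ u in (0:ℝ)..1, (1 - u) ^ (μ - 1) * g (x * u)) := by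
    refine continuous_const.mul ((Real.continuous_rpow_const hμ.le).mul ?_)
    refine continuous_iff_continuousAt.2 fun x₀ => ?_
    obtain ⟨M, hM⟩ := isCompact_Icc.exists_bound_of_continuousOn
      (hg.continuousOn (s := Icc (-(|x₀| + 1)) (|x₀| + 1)))
    refine intervalIntegral.continuousAt_of_dominated_interval
      (bound := fun u => (1 - u) ^ (μ - 1) * M) ?_ ?_ ?_ ?_
    · refine Eventually.of_forall fun x => Measurable.aestronglyMeasurable ?_
      exact ((measurable_const.sub measurable_id).pow_const _).mul
        (hg.measurable.comp (measurable_const.mul measurable_id))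
    · filter_upwards [Metric.ball_mem_nhds x₀ one_pos] with x hx
      refine Eventually.of_forall fun u hu => ?_
      rw [uIoc_of_le zero_le_one] at hu
      have h1 := Real.rpow_nonneg (show 0 ≤ 1 - u by linarith [hu.2]) (μ - 1)
      rw [norm_mul, Real.norm_of_nonneg h1]
      refine mul_le_mul_of_nonneg_left (hM _ ?_) h1
      rw [mem_Icc, ← abs_le, abs_mul, abs_of_pos hu.1]
      rw [Metric.mem_ball, Real.dist_eq] at hx
      have := abs_sub_abs_le_abs_sub x x₀
      nlinarith [abs_nonneg x, hu.2, hu.1]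
    · have := (intervalIntegral.intervalIntegrable_rpow' (a := 1) (b := 0) (r := μ - 1)
        (by linarith)).comp_sub_left 1 enorm_ne_top
      simpa using this.mul_const M
    · refine Eventually.of_forall fun u _ => ?_
      fun_prop
  exact hc.continuousOn.congr fun x hx => fracInt_eq_rpow_mul hμ hx g

lemma mul_le_integral_truncKernel_sub {α : ℝ} (hα : α ∈ Ioo (0:ℝ) 1) {ε δ x b : ℝ} (hε : 0 < ε)
    (hδ : 0 ≤ δ) (hδx : δ < x) (hxb : x ≤ b) :
    δ * truncKernel α ε x ≤
      ∫ t in (0:ℝ)..b, (truncKernel α ε (x - t) - truncKernel α ε (x - δ - t)) := by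
  have hi : ∀ p q, IntervalIntegrable (truncKernel α ε) volume p q := fun p q => by
    simpa using (intervalIntegrable_truncKernel_mul hα hε continuous_one 0 (-p) (-q)).comp_sub_left
      0 enorm_ne_top
  have hi' : ∀ z, IntervalIntegrable (fun t => truncKernel α ε (z - t)) volume 0 b := fun z => by
    simpa using intervalIntegrable_truncKernel_mul hα hε continuous_one z 0 b
  have hneg : ∀ p q, p ≤ q → q ≤ 0 → ∫ r in p..q, truncKernel α ε r = 0 := by
    intro p q hpq hq
    refine intervalIntegral.integral_zero_ae (Eventually.of_forall fun r hr => ?_)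
    rw [uIoc_of_le hpq] at hr
    exact truncKernel_of_nonpos α ε (hr.2.trans hq)
  rw [intervalIntegral.integral_sub (hi' _) (hi' _), intervalIntegral.integral_comp_sub_left,
    intervalIntegral.integral_comp_sub_left, sub_zero, sub_zero,
    ← intervalIntegral.integral_add_adjacent_intervals (hi (x - b) 0) (hi 0 x),
    ← intervalIntegral.integral_add_adjacent_intervals (hi (x - δ - b) 0) (hi 0 (x - δ)),
    hneg (x - b) 0 (by linarith) le_rfl, hneg (x - δ - b) 0 (by linarith) le_rfl,
    ← intervalIntegral.integral_add_adjacent_intervals (hi 0 (x - δ)) (hi (x - δ) x)]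
  have h : ∫ _ in (x - δ)..x, truncKernel α ε x ≤ ∫ r in (x - δ)..x, truncKernel α ε r := by
    refine intervalIntegral.integral_mono_on (by linarith) (by simp) (hi _ _) fun r hr => ?_
    exact truncKernel_anti hα hε (by linarith [hr.1]) hr.2
  rw [intervalIntegral.integral_const, smul_eq_mul, sub_sub_cancel] at h
  linarith

lemma intervalIntegral_indicator_Icc_const {a b p q C : ℝ} (ha : a ≤ p) (hpq : p ≤ q)
    (hb : q ≤ b) : ∫ t in a..b, (Icc p q).indicator (fun _ => C) t = C * (q - p) := by
  rw [intervalIntegral.integral_of_le (ha.trans (hpq.trans hb)), ← integral_Icc_eq_integral_Ioc,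
    setIntegral_indicator measurableSet_Icc, inter_eq_right.2 (Icc_subset_Icc ha hb),
    setIntegral_const, smul_eq_mul, Real.volume_real_Icc_of_le hpq, mul_comm]

/-- Comparison of increments of a fractional integral near a running maximum `x₁` of `g` and near
a later zero `b` of `g`. -/
lemma exists_increment_lt {α : ℝ} (hα : α ∈ Ioo (0:ℝ) 1) {g : ℝ → ℝ} (hg : Continuous g)
    {x₁ b η θ : ℝ} (hη : 0 < η) (hηx : η < x₁) (hxb : x₁ < b)
    (hmax : ∀ t ∈ Icc 0 x₁, g t ≤ g x₁) (hpos : ∀ t ∈ Ico (x₁ - η) b, 0 < g t) (hb : g b = 0)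
    (hθ0 : 0 ≤ θ) (hθ1 : θ ≤ 1) :
    ∃ p q, x₁ - η ≤ p ∧ p < q ∧ q ≤ x₁ ∧
      θ * (fracInt (1 - α) g (q + (b - x₁)) - fracInt (1 - α) g (p + (b - x₁))) <
        fracInt (1 - α) g q - fracInt (1 - α) g p := by
  set F := fracInt (1 - α) g with hF
  set m := g x₁ with hm
  have hm0 : 0 < m := hpos x₁ ⟨by linarith, hxb⟩
  set ε := η / 2 with hε'
  have hε : 0 < ε := by positivity
  set T := truncKernel α ε with hT
  set B := incBeta α 1 with hB'
  have hB : 0 < B := incBeta_pos hα one_pos le_rfl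
  have hTx : 0 < T x₁ := truncKernel_pos hα hε (by linarith)
  set ω := m * T x₁ / (3 * B) with hω'
  have hω : 0 < ω := by positivity
  obtain ⟨δ₁, hδ₁, h1⟩ := Metric.continuous_iff.1 hg x₁ ω hω
  obtain ⟨δ₂, hδ₂, h2⟩ := Metric.continuous_iff.1 hg b ω hω
  obtain ⟨δ, hδ, hδlt⟩ := exists_between
    (show 0 < min (min δ₁ δ₂) (min (η / 2) (b - x₁)) from
      lt_min (lt_min hδ₁ hδ₂) (lt_min hε (by linarith)))
  simp only [lt_min_iff] at hδlt
  obtain ⟨⟨hd1, hd2⟩, hd3, hd4⟩ := hδlt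
  have hg1 : ∀ t ∈ Icc (x₁ - δ) x₁, m - ω ≤ g t := by
    intro t ht
    have := h1 t (by rw [Real.dist_eq, abs_lt]; constructor <;> linarith [ht.1, ht.2])
    rw [Real.dist_eq, abs_lt] at this
    linarith [this.1]
  have hg2 : ∀ t ∈ Icc (b - δ) b, g t ≤ ω := by
    intro t ht
    have := h2 t (by rw [Real.dist_eq, abs_lt]; constructor <;> linarith [ht.1, ht.2])
    rw [Real.dist_eq, abs_lt, hb] at this
    linarith [this.2]
  by_contra! H
  have hFc : ContinuousOn F (Ici 0) := continuousOn_fracInt (by linarith [hα.2]) hg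
  have hIi : ∀ x, ε ≤ x →
      IntervalIntegrable (fun s => s ^ (α - 1) * F (x - s)) volume 0 ε := by
    intro x hx
    refine (intervalIntegral.intervalIntegrable_rpow' (by linarith [hα.1])).mul_continuousOn ?_
    refine hFc.comp (by fun_prop) fun s hs => ?_
    rw [uIcc_of_le hε.le] at hs
    simp only [mem_Ici]
    linarith [hs.2]
  have hle : (∫ s in (0:ℝ)..ε, s ^ (α - 1) * F (x₁ - s)) -
      (∫ s in (0:ℝ)..ε, s ^ (α - 1) * F (x₁ - δ - s)) ≤
      θ * ((∫ s in (0:ℝ)..ε, s ^ (α - 1) * F (b - s)) -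
        ∫ s in (0:ℝ)..ε, s ^ (α - 1) * F (b - δ - s)) := by
    have i1 := hIi x₁ (by linarith)
    have i2 := hIi (x₁ - δ) (by linarith)
    have i3 := hIi b (by linarith)
    have i4 := hIi (b - δ) (by linarith)
    rw [← intervalIntegral.integral_sub i1 i2, ← intervalIntegral.integral_sub i3 i4,
      ← intervalIntegral.integral_const_mul]
    refine intervalIntegral.integral_mono_on hε.le (i1.sub i2) ((i3.sub i4).const_mul θ)
      fun s hs => ?_
    have := H (x₁ - δ - s) (x₁ - s) (by linarith [hs.2]) (by linarith) (by linarith [hs.1])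
    rw [show x₁ - s + (b - x₁) = b - s by ring,
      show x₁ - δ - s + (b - x₁) = b - δ - s by ring] at this
    have := mul_le_mul_of_nonneg_left this (Real.rpow_nonneg hs.1 (α - 1))
    linarith
  have hc : 0 < 1 / Real.Gamma (1 - α) :=
    one_div_pos.2 (Real.Gamma_pos_of_pos (by linarith [hα.2]))
  rw [integral_rpow_mul_fracInt hα hg hε (X := b) (by linarith) (by linarith),
    integral_rpow_mul_fracInt hα hg hε (X := b) (by linarith) (by linarith),
    integral_rpow_mul_fracInt hα hg hε (X := b) (by linarith) (by linarith),
    integral_rpow_mul_fracInt hα hg hε (X := b) (by linarith) (by linarith)] at hle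
  have hTi := fun x => intervalIntegrable_truncKernel_mul hα hε hg x 0 b
  have hle' : ∫ t in (0:ℝ)..b, (T (x₁ - t) * g t - T (x₁ - δ - t) * g t -
      θ * (T (b - t) * g t - T (b - δ - t) * g t)) ≤ 0 := by
    rw [intervalIntegral.integral_sub ((hTi _).sub (hTi _)) (((hTi _).sub (hTi _)).const_mul θ),
      intervalIntegral.integral_const_mul, intervalIntegral.integral_sub (hTi _) (hTi _),
      intervalIntegral.integral_sub (hTi _) (hTi _)]
    refine le_of_mul_le_mul_left ?_ hc
    linarith
  have hTi1 : ∀ x, IntervalIntegrable (fun t => T (x - t)) volume 0 b := fun x => by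
    simpa using intervalIntegrable_truncKernel_mul hα hε continuous_one x 0 b
  have hind : ∀ p q : ℝ,
      IntervalIntegrable ((Icc p q).indicator fun _ => B * ω) volume 0 b := fun p q => by
    rw [intervalIntegrable_iff]
    exact (intervalIntegrable_const (c := B * ω)).def'.indicator measurableSet_Icc
  have hge : ∫ t in (0:ℝ)..b, (m * (T (x₁ - t) - T (x₁ - δ - t)) -
      (Icc (x₁ - δ) x₁).indicator (fun _ => B * ω) t -
      (Icc (b - δ) b).indicator (fun _ => B * ω) t) ≤
      ∫ t in (0:ℝ)..b, (T (x₁ - t) * g t - T (x₁ - δ - t) * g t -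
      θ * (T (b - t) * g t - T (b - δ - t) * g t)) := by
    refine intervalIntegral.integral_mono_on (by linarith)
      (((((hTi1 _).sub (hTi1 _)).const_mul m).sub (hind _ _)).sub (hind _ _))
      (((hTi _).sub (hTi _)).sub (((hTi _).sub (hTi _)).const_mul θ)) fun t ht => ?_
    have hTn : ∀ r, 0 ≤ T r := truncKernel_nonneg hα hε
    have hTB : ∀ r, T r ≤ B := truncKernel_le hα hε
    have hTz : ∀ r, r ≤ 0 → T r = 0 := fun r hr => truncKernel_of_nonpos α ε hr
    have hTa : ∀ r r', 0 < r → r ≤ r' → T r' ≤ T r := fun r r' => truncKernel_anti hα hε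
    have hBω : 0 ≤ B * ω := by positivity
    have hi1 := indicator_nonneg (s := Icc (x₁ - δ) x₁) (f := fun _ => B * ω) (fun _ _ => hBω) t
    have hi2 := indicator_nonneg (s := Icc (b - δ) b) (f := fun _ => B * ω) (fun _ _ => hBω) t
    rcases lt_or_ge t (x₁ - δ) with ht1 | ht1
    · have hA : T (x₁ - t) ≤ T (x₁ - δ - t) := hTa _ _ (by linarith) (by linarith)
      have hD : T (b - t) ≤ T (b - δ - t) := hTa _ _ (by linarith) (by linarith)
      have hθD : 0 ≤ θ * (T (b - δ - t) - T (b - t)) := mul_nonneg hθ0 (by linarith)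
      have hgm : g t ≤ m := hmax t ⟨ht.1, by linarith⟩
      rcases le_or_gt t (x₁ - η) with ht2 | ht2
      · have hDA := truncKernel_sub_le hα hε (p := x₁ - δ - t) (d := b - x₁) (by linarith) hδ.le
          (by linarith)
        rw [show x₁ - δ - t + (b - x₁) = b - δ - t by ring, show b - δ - t + δ = b - t by ring,
          show x₁ - δ - t + δ = x₁ - t by ring] at hDA
        have h1 : θ * (T (b - δ - t) - T (b - t)) ≤ T (x₁ - δ - t) - T (x₁ - t) :=
          (mul_le_of_le_one_left (by linarith) hθ1).trans hDA
        have h2 := mul_le_mul_of_nonneg_left hgm (sub_nonneg.2 h1)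
        have h3 := mul_nonneg hθD hm0.le
        linarith
      · have hgt := hpos t ⟨ht2.le, by linarith⟩
        have h1 := mul_le_mul_of_nonneg_left hgm (sub_nonneg.2 hA)
        have h2 := mul_nonneg hθD hgt.le
        linarith
    · rw [hTz (x₁ - δ - t) (by linarith)]
      rcases le_or_gt t x₁ with ht2 | ht2
      · rw [indicator_of_mem (show t ∈ Icc (x₁ - δ) x₁ from ⟨ht1, ht2⟩)]
        have hD : T (b - t) ≤ T (b - δ - t) := hTa _ _ (by linarith) (by linarith)
        have hθD : 0 ≤ θ * (T (b - δ - t) - T (b - t)) := mul_nonneg hθ0 (by linarith)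
        have hgt := hpos t ⟨by linarith, by linarith⟩
        have h1 := mul_le_mul_of_nonneg_left (hg1 t ⟨ht1, ht2⟩) (hTn (x₁ - t))
        have h2 := mul_le_mul_of_nonneg_right (hTB (x₁ - t)) hω.le
        have h3 := mul_nonneg hθD hgt.le
        linarith
      · rw [hTz (x₁ - t) (by linarith)]
        rcases lt_or_ge t (b - δ) with ht3 | ht3
        · have hD : T (b - t) ≤ T (b - δ - t) := hTa _ _ (by linarith) (by linarith)
          have hθD : 0 ≤ θ * (T (b - δ - t) - T (b - t)) := mul_nonneg hθ0 (by linarith)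
          have h3 := mul_nonneg hθD (hpos t ⟨by linarith, by linarith⟩).le
          linarith
        · rw [hTz (b - δ - t) (by linarith),
            indicator_of_mem (show t ∈ Icc (b - δ) b from ⟨ht3, ht.2⟩)]
          have hgt : 0 ≤ g t := by
            rcases ht.2.eq_or_lt with rfl | h
            · exact hb.ge
            · exact (hpos t ⟨by linarith, h⟩).le
          have h1 : T (b - t) * g t ≤ B * ω := mul_le_mul (hTB _) (hg2 t ⟨ht3, ht.2⟩) hgt hB.le
          have h2 : θ * (T (b - t) * g t) ≤ T (b - t) * g t :=
            mul_le_of_le_one_left (mul_nonneg (hTn _) hgt) hθ1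
          linarith
  rw [intervalIntegral.integral_sub ((((hTi1 _).sub (hTi1 _)).const_mul m).sub (hind _ _))
      (hind _ _), intervalIntegral.integral_sub (((hTi1 _).sub (hTi1 _)).const_mul m) (hind _ _),
    intervalIntegral.integral_const_mul,
    intervalIntegral_indicator_Icc_const (by linarith) (by linarith) hxb.le,
    intervalIntegral_indicator_Icc_const (by linarith) (by linarith) le_rfl] at hge
  have hlow := mul_le_mul_of_nonneg_left
    (mul_le_integral_truncKernel_sub hα hε hδ.le (show δ < x₁ by linarith) hxb.le) hm0.le
  have hBω : B * ω = m * T x₁ / 3 := by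
    rw [hω']
    field_simp
  rw [hBω] at hge
  have : 0 < δ * (m * T x₁) := by positivity
  simp only [sub_sub_cancel] at hge
  linarith

/-- If `x y' = g` and the fractional integral of `g` has derivative `x ^ (2 - α) y` wherever
`g` does not vanish, then `g` stays positive once it is positive. -/
lemma pos_of_pos_of_le {α : ℝ} (hα : α ∈ Ioo (0:ℝ) 1) {g y : ℝ → ℝ} (hg : Continuous g)
    (hg0 : g 0 = 0) (hyd : ∀ x, 0 < x → g x ≠ 0 → HasDerivAt y (g x / x) x)
    (hFd : ∀ x, 0 < x → g x ≠ 0 → HasDerivAt (fracInt (1 - α) g) (x ^ (2 - α) * y x) x)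
    {x z : ℝ} (hx : 0 < x) (hgx : 0 < g x) (hxz : x ≤ z) : 0 < g z := by
  by_contra! hz
  obtain ⟨x₁, hx₁, hmax⟩ := isCompact_Icc.exists_isMaxOn (nonempty_Icc.2 hx.le) hg.continuousOn
  have hm : 0 < g x₁ := hgx.trans_le (hmax ⟨hx.le, le_rfl⟩)
  have hx₁0 : 0 < x₁ := hx₁.1.lt_of_ne fun h => by
    rw [← h, hg0] at hm
    exact hm.false
  have hx₁z : x₁ ≤ z := hx₁.2.trans hxz
  have hSc : IsCompact (Icc x₁ z ∩ {t | g t ≤ 0}) :=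
    isCompact_Icc.inter_right (isClosed_le hg continuous_const)
  obtain ⟨b, ⟨⟨hb1, hbz⟩, hgb⟩, hbl⟩ := hSc.exists_isLeast ⟨z, ⟨hx₁z, le_rfl⟩, hz⟩
  have hpos₁ : ∀ t, x₁ ≤ t → t < b → 0 < g t := fun t h1 h2 => by
    by_contra! h
    exact (hbl ⟨⟨h1, h2.le.trans hbz⟩, h⟩).not_gt h2
  have hxb : x₁ < b := hb1.lt_of_ne fun h => by
    rw [← h] at hgb
    exact hm.not_ge hgb
  have hb0 : g b = 0 := by
    obtain ⟨t, ht, hgt⟩ := intermediate_value_Icc' hb1 hg.continuousOn ⟨hgb, hm.le⟩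
    rcases ht.2.eq_or_lt with h | h
    · rw [← h, hgt]
    · exact absurd hgt (hpos₁ t ht.1 h).ne'
  obtain ⟨η', hη', hη'g⟩ := Metric.eventually_nhds_iff.1 (hg.continuousAt.eventually_const_lt hm)
  obtain ⟨η, hη, hηlt⟩ := exists_between (lt_min hη' hx₁0)
  rw [lt_min_iff] at hηlt
  have hpos : ∀ t ∈ Ico (x₁ - η) b, 0 < g t := fun t ht => by
    rcases le_or_gt x₁ t with h | h
    · exact hpos₁ t h ht.2
    · refine hη'g ?_
      rw [Real.dist_eq, abs_lt]
      constructor <;> linarith [ht.1, ht.2]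
  have hpos0 : ∀ t ∈ Ico (x₁ - η) b, 0 < t := fun t ht => by linarith [ht.1]
  have hmax' : ∀ t ∈ Icc 0 x₁, g t ≤ g x₁ := fun t ht => hmax ⟨ht.1, ht.2.trans hx₁.2⟩
  have hy' : ∀ t ∈ Ico (x₁ - η) b, HasDerivAt y (g t / t) t := fun t ht =>
    hyd t (hpos0 t ht) (hpos t ht).ne'
  have hF' : ∀ t ∈ Ico (x₁ - η) b, HasDerivAt (fracInt (1 - α) g) (t ^ (2 - α) * y t) t :=
    fun t ht => hFd t (hpos0 t ht) (hpos t ht).ne'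
  have hym : StrictMonoOn y (Ico (x₁ - η) b) := by
    refine strictMonoOn_of_deriv_pos (convex_Ico _ _)
      (fun t ht => (hy' t ht).continuousAt.continuousWithinAt) fun t ht => ?_
    have ht' := interior_subset ht
    rw [(hy' t ht').deriv]
    exact div_pos (hpos t ht') (hpos0 t ht')
  obtain ⟨p, q, hp, hpq, hq, hlt⟩ := exists_increment_lt hα hg hη hηlt.2 hxb hmax' hpos hb0
    le_rfl zero_le_one
  rw [zero_mul] at hlt
  obtain ⟨ξ, hξ, hξs⟩ := exists_hasDerivAt_eq_slope (fracInt (1 - α) g)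
    (fun t => t ^ (2 - α) * y t) hpq
    (fun t ht => (hF' t ⟨hp.trans ht.1, by linarith [ht.2]⟩).continuousAt.continuousWithinAt)
    (fun t ht => hF' t ⟨hp.trans ht.1.le, by linarith [ht.2]⟩)
  have hξm : ξ ∈ Ico (x₁ - η) b := ⟨hp.trans hξ.1.le, by linarith [hξ.2]⟩
  have hξy : 0 < y ξ := by
    have : 0 < ξ ^ (2 - α) * y ξ := by
      rw [hξs]
      exact div_pos hlt (sub_pos.2 hpq)
    exact pos_of_mul_pos_right this (Real.rpow_nonneg (hpos0 ξ hξm).le _)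
  have hξx : ξ < x₁ := hξ.2.trans_le hq
  have hhm : ∀ s t, ξ ≤ s → s ≤ t → t < b → s ^ (2 - α) * y s ≤ t ^ (2 - α) * y t := by
    intro s t hs hst ht
    have hs' : s ∈ Ico (x₁ - η) b := ⟨hξm.1.trans hs, by linarith⟩
    have ht' : t ∈ Ico (x₁ - η) b := ⟨hs'.1.trans hst, ht⟩
    refine mul_le_mul (Real.rpow_le_rpow (hpos0 s hs').le hst (by linarith [hα.2]))
      (hym.monotoneOn hs' ht' hst) ?_ (Real.rpow_nonneg (hpos0 t ht').le _)
    exact hξy.le.trans (hym.monotoneOn hξm hs' hs)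
  obtain ⟨p', q', hp', hpq', hq', hlt'⟩ := exists_increment_lt hα hg (η := x₁ - ξ) (θ := 1)
    (by linarith) (by linarith [hpos0 ξ hξm]) hxb hmax'
    (fun t ht => hpos t ⟨by linarith [ht.1, hξm.1], ht.2⟩) hb0 zero_le_one le_rfl
  have hFc : ContinuousOn (fracInt (1 - α) g) (Ici 0) :=
    continuousOn_fracInt (by linarith [hα.2]) hg
  have hξ0 := hpos0 ξ hξm
  have hG : MonotoneOn (fun t => fracInt (1 - α) g (t + (b - x₁)) - fracInt (1 - α) g t)
      (Icc ξ x₁) := by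
    have hGd : ∀ t ∈ Ioo ξ x₁,
        HasDerivAt (fun t => fracInt (1 - α) g (t + (b - x₁)) - fracInt (1 - α) g t)
          ((t + (b - x₁)) ^ (2 - α) * y (t + (b - x₁)) - t ^ (2 - α) * y t) t := fun t ht =>
      ((hF' (t + (b - x₁)) ⟨by linarith [hξm.1, ht.1], by linarith [ht.2]⟩).comp_add_const
        t (b - x₁)).sub (hF' t ⟨by linarith [hξm.1, ht.1], by linarith [ht.2]⟩)
    refine monotoneOn_of_deriv_nonneg (convex_Icc _ _) ?_ ?_ ?_
    · refine (hFc.comp (by fun_prop) fun t ht => ?_).sub (hFc.mono fun t ht => ?_)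
      · simp only [mem_Ici]
        linarith [ht.1]
      · exact hξ0.le.trans ht.1
    · rw [interior_Icc]
      exact fun t ht => (hGd t ht).differentiableAt.differentiableWithinAt
    · rw [interior_Icc]
      intro t ht
      rw [(hGd t ht).deriv, sub_nonneg]
      exact hhm _ _ ht.1.le (by linarith) (by linarith [ht.2])
  have := hG ⟨by linarith, by linarith⟩ ⟨by linarith, hq'⟩ hpq'.le
  simp only at this
  linarith

/-- A function whose derivative is `h` near `x` wherever `h ≠ 0` is differentiable at `x`, as soon
as `h` vanishes at most at `x` locally. -/
lemma hasDerivAt_of_eventually_ne_zero {F h : ℝ → ℝ} {x : ℝ} (hF : ContinuousAt F x)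
    (hh : ContinuousAt h x) (hd : ∀ᶠ t in 𝓝 x, deriv F t = h t) (hne : ∀ᶠ t in 𝓝[≠] x, h t ≠ 0) :
    HasDerivAt F (h x) x := by
  set s := {t | deriv F t = h t ∧ h t ≠ 0}
  have hs : s ∈ 𝓝[≠] x := (hd.filter_mono nhdsWithin_le_nhds).and hne
  have hFs : DifferentiableOn ℝ F s := fun t ht =>
    (differentiableAt_of_deriv_ne_zero (ht.1.trans_ne ht.2)).differentiableWithinAt
  have hlim : Tendsto (deriv F) (𝓝 x) (𝓝 (h x)) :=
    hh.tendsto.congr' (hd.mono fun t ht => ht.symm)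
  have h1 := hasDerivWithinAt_Ici_of_tendsto_deriv hFs hF.continuousWithinAt
    (nhdsWithin_mono _ (fun t ht => ne_of_gt ht) hs) (hlim.mono_left nhdsWithin_le_nhds)
  have h2 := hasDerivWithinAt_Iic_of_tendsto_deriv hFs hF.continuousWithinAt
    (nhdsWithin_mono _ (fun t ht => ne_of_lt ht) hs) (hlim.mono_left nhdsWithin_le_nhds)
  simpa using h1.union h2

lemma fracInt_congr {μ x : ℝ} (hx : 0 ≤ x) {f g : ℝ → ℝ} (h : ∀ t ∈ Icc 0 x, f t = g t) :
    fracInt μ f x = fracInt μ g x := by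
  rw [fracInt, fracInt]
  congr 1
  refine intervalIntegral.integral_congr fun t ht => ?_
  rw [uIcc_of_le hx] at ht
  simp only [h t ht]

lemma fracInt_neg (μ : ℝ) (g : ℝ → ℝ) : fracInt μ (-g) = -fracInt μ g := by
  ext x
  simp [fracInt]

lemma fracInt_zero_right (μ : ℝ) (g : ℝ → ℝ) : fracInt μ g 0 = 0 := by
  simp [fracInt]

/-- If `g` and `h` are continuous and the integral of order `1 - α` of `g` is a primitive of `h`,
then `g` is the integral of order `α` of `h`. -/
lemma eq_fracInt_of_fracInt_eq_integral {α : ℝ} (hα : α ∈ Ioo (0:ℝ) 1) {g h : ℝ → ℝ}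
    (hg : Continuous g) (hh : Continuous h)
    (H : ∀ x, 0 < x → fracInt (1 - α) g x = ∫ t in (0:ℝ)..x, h t) {x : ℝ} (hx : 0 < x) :
    g x = fracInt α h x := by
  have hα' : 1 - α ∈ Ioo (0:ℝ) 1 := ⟨by linarith [hα.2], by linarith [hα.1]⟩
  set G := fun t => fracInt α h (max t 0)
  have hG : Continuous G := (continuousOn_fracInt hα.1 hh).comp_continuous
    (continuous_id.max continuous_const) fun t => le_max_right t 0
  have h1 : ∀ z, 0 ≤ z → fracInt (1 - α) G z = fracInt (1 - α) g z := by
    intro z hz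
    rcases hz.eq_or_lt with rfl | hz
    · simp only [fracInt_zero_right]
    · rw [H z hz, ← fracInt_fracInt hα' hh hz, sub_sub_cancel]
      exact fracInt_congr hz.le fun t ht => by simp only [G, max_eq_left ht.1]
  have h2 : ∀ z, 0 < z → ∫ t in (0:ℝ)..z, G t = ∫ t in (0:ℝ)..z, g t := by
    intro z hz
    rw [← fracInt_fracInt hα hg hz, ← fracInt_fracInt hα hG hz]
    exact fracInt_congr hz.le fun t ht => h1 t ht.1
  have h3 := (hG.integral_hasStrictDerivAt 0 x).hasDerivAt
  have h4 := (hg.integral_hasStrictDerivAt 0 x).hasDerivAt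
  have h5 := h4.congr_of_eventuallyEq
    ((eventually_gt_nhds hx).mono fun z hz => h2 z hz)
  have h6 := h5.unique h3
  rw [h6]
  simp only [G, max_eq_left hx.le]

/-- The fractional integral of order `1 - α` of `x y'` is the primitive of `x ^ (2 - α) y`, if it
has this derivative in the sense of `deriv`. -/
lemma fracInt_eq_integral_of_deriv {α : ℝ} (hα : α ∈ Ioo (0:ℝ) 1) {y : ℝ → ℝ}
    (hy : ContinuousOn y (Ici 0)) (hg : Continuous fun x => x * deriv y x)
    (hd : ∀ x, 0 < x →
      deriv (fracInt (1 - α) fun t => t * deriv y t) x = x ^ (2 - α) * y x)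
    {x : ℝ} (hx : 0 < x) :
    fracInt (1 - α) (fun t => t * deriv y t) x = ∫ t in (0:ℝ)..x, t ^ (2 - α) * y t := by
  set g := fun x => x * deriv y x with hgdef
  set F := fracInt (1 - α) g with hFdef
  have hFc : ContinuousOn F (Ici 0) := continuousOn_fracInt (by linarith [hα.2]) hg
  have hhc : ContinuousOn (fun t => t ^ (2 - α) * y t) (Ici 0) :=
    (Real.continuous_rpow_const (by linarith [hα.2])).continuousOn.mul hy
  have hg0 : g 0 = 0 := zero_mul _
  have hyd : ∀ x, 0 < x → g x ≠ 0 → HasDerivAt y (g x / x) x := by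
    intro x hx hgx
    rw [hgdef, mul_div_cancel_left₀ _ hx.ne']
    exact (differentiableAt_of_deriv_ne_zero (right_ne_zero_of_mul hgx)).hasDerivAt
  have hFd : ∀ x, 0 < x → g x ≠ 0 → HasDerivAt F (x ^ (2 - α) * y x) x := by
    intro x hx hgx
    by_cases hyx : y x = 0
    · refine hasDerivAt_of_eventually_ne_zero (h := fun t => t ^ (2 - α) * y t)
        (hFc.continuousAt (Ici_mem_nhds hx)) (hhc.continuousAt (Ici_mem_nhds hx))
        ((eventually_gt_nhds hx).mono hd) ?_
      filter_upwards [(hyd x hx hgx).eventually_ne (c := 0) (div_ne_zero hgx hx.ne'),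
        nhdsWithin_le_nhds (eventually_gt_nhds hx)] with t ht ht0
      exact mul_ne_zero (Real.rpow_pos_of_pos ht0 _).ne' ht
    · rw [← hd x hx]
      refine (differentiableAt_of_deriv_ne_zero ?_).hasDerivAt
      rw [hd x hx]
      exact mul_ne_zero (Real.rpow_pos_of_pos hx _).ne' hyx
  have hup : ∀ x z, 0 < x → g x ≠ 0 → x ≤ z → g z ≠ 0 := by
    intro x z hx hgx hxz
    rcases hgx.lt_or_gt with h | h
    · refine (neg_pos.1 (pos_of_pos_of_le (g := -g) (y := -y) hα hg.neg (by simp [hg0])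
        (fun t ht hgt => ?_) (fun t ht hgt => ?_) hx (neg_pos.2 h) hxz)).ne
      · simpa [neg_div] using (hyd t ht (by simpa using hgt)).neg
      · rw [fracInt_neg]
        simpa using (hFd t ht (by simpa using hgt)).neg
    · exact (pos_of_pos_of_le hα hg hg0 hyd hFd hx h hxz).ne'
  set S := {x : ℝ | 0 < x ∧ g x = 0 ∧ ∀ z, x < z → g z ≠ 0}
  have hS : S.Countable := by
    refine Set.Subsingleton.countable fun p hp q hq => ?_
    by_contra hpq
    rcases lt_or_gt_of_ne hpq with h | h
    · exact hp.2.2 q h hq.2.1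
    · exact hq.2.2 p h hp.2.1
  have hFS : ∀ t, 0 < t → t ∉ S → HasDerivAt F (t ^ (2 - α) * y t) t := by
    intro t ht htS
    by_cases hgt : g t = 0
    · obtain ⟨z, htz, hgz⟩ : ∃ z, t < z ∧ g z = 0 := by
        by_contra! h
        exact htS ⟨ht, hgt, h⟩
      have hF0 : F =ᶠ[𝓝 t] fun _ => 0 := by
        filter_upwards [Ioo_mem_nhds ht htz] with s hs
        rw [hFdef, fracInt_congr (g := fun _ => 0) hs.1.le fun r hr => ?_]
        · simp [fracInt]
        · by_contra hgr
          have hr0 : 0 < r := hr.1.lt_of_ne fun h => hgr (h ▸ hg0)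
          exact hup r z hr0 hgr (hr.2.trans hs.2.le) hgz
      have := (hasDerivAt_const t (0:ℝ)).congr_of_eventuallyEq hF0
      rwa [← hd t ht, this.deriv]
    · exact hFd t ht hgt
  have := integral_eq_of_hasDerivAt_off_countable_of_le F (fun t => t ^ (2 - α) * y t) hx.le hS
    (hFc.mono Icc_subset_Ici_self) (fun t ht => hFS t ht.1.1 ht.2)
    (by
      refine ContinuousOn.intervalIntegrable (hhc.mono ?_)
      rw [uIcc_of_le hx.le]
      exact Icc_subset_Ici_self)
  rw [this, hFdef, fracInt_zero_right, sub_zero]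

theorem volterra_integro_differential (α : ℝ) (hα : α ∈ Set.Ioo (0:ℝ) 1) (y : ℝ → ℝ)
    (hy : ContinuousOn y (Set.Ici 0))
    (hg0 : Filter.Tendsto (fun x => x * deriv y x) (nhdsWithin 0 (Set.Ioi 0)) (nhds 0))
    (hgcont : Continuous fun x => x * deriv y x)
    (heq : ∀ x : ℝ, 0 < x →
      x ^ α * fracDeriv α (fun t => t * deriv y t) x = x ^ 2 * y x) :
    ∀ x : ℝ, 0 < x →
      deriv y x = (1 / Real.Gamma α) * (1 / x) *
        ∫ t in (0:ℝ)..x, (x - t) ^ (α - 1) * t ^ (2 - α) * y t := by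
  intro x hx
  have hd : ∀ z, 0 < z →
      deriv (fracInt (1 - α) fun t => t * deriv y t) z = z ^ (2 - α) * y z := by
    intro z hz
    have h := heq z hz
    have hz2 : z ^ 2 = z ^ α * z ^ (2 - α) := by
      rw [← Real.rpow_add hz, add_sub_cancel, Real.rpow_two]
    rw [hz2, mul_assoc] at h
    exact mul_left_cancel₀ (Real.rpow_pos_of_pos hz α).ne' h
  set h : ℝ → ℝ := fun t => max t 0 ^ (2 - α) * y (max t 0) with hh
  have hmax : Continuous fun t : ℝ => max t 0 := continuous_id.max continuous_const
  have hhc : Continuous h := ((Real.continuous_rpow_const (by linarith [hα.2])).comp hmax).mul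
    (hy.comp_continuous hmax fun t => le_max_right t 0)
  have key := eq_fracInt_of_fracInt_eq_integral hα hgcont hhc (fun z hz => by
    rw [fracInt_eq_integral_of_deriv hα hy hgcont hd hz]
    refine intervalIntegral.integral_congr fun t ht => ?_
    rw [uIcc_of_le hz.le] at ht
    simp only [hh, max_eq_left ht.1]) hx
  rw [fracInt_congr (g := fun t => t ^ (2 - α) * y t) hx.le
    fun t ht => by simp only [hh, max_eq_left ht.1]] at key
  simp only [fracInt, ← mul_assoc] at key
  rw [mul_right_comm, ← key]
  field_simp
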